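/- arXiv:1810.05949 — 2 statements merged into one kernel-verified Lean document; each statement's English description precedes it below -/
import Mathlib

section
/- Let ε > 0 and N > 0. There exists a unique γ* > 0 satisfying the exact covertness equation N·(ln(1+γ*) − γ*/(1+γ*)) = 2ε², and this exact root satisfies γ* > γ⁺ = (ε² + √(ε⁴ + 2ε²N))/N, i.e., the approximate root underestimates the exact one. -/
theorem strictMonoOn_log_one_add_sub_div :
    StrictMonoOn (fun γ : ℝ => Real.log (1 + γ) - γ / (1 + γ)) (Set.Ioi 0) := by
  intro a ha b hb hab
  rw [Set.mem_Ioi] at ha hb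
  have ha' : 0 < 1 + a := by linarith
  have hb' : 0 < 1 + b := by linarith
  have hlog := Real.one_sub_inv_le_log_of_pos (div_pos hb' ha')
  rw [Real.log_div hb'.ne' ha'.ne'] at hlog
  have hdiff : 1 - ((1 + b) / (1 + a))⁻¹ - (b / (1 + b) - a / (1 + a))
      = a * (b - a) / ((1 + a) * (1 + b)) := by
    field_simp
    ring
  have hpos : 0 < a * (b - a) / ((1 + a) * (1 + b)) :=
    div_pos (mul_pos ha (sub_pos.2 hab)) (mul_pos ha' hb')
  change Real.log (1 + a) - a / (1 + a) < Real.log (1 + b) - b / (1 + b)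
  linarith

theorem exists_pos_log_one_add_sub_div_eq {c : ℝ} (hc : 0 < c) :
    ∃ γ : ℝ, 0 < γ ∧ Real.log (1 + γ) - γ / (1 + γ) = c := by
  set M : ℝ := Real.exp (c + 1)
  have hM : 0 < M := Real.exp_pos _
  have hcont : ContinuousOn (fun γ : ℝ => Real.log (1 + γ) - γ / (1 + γ)) (Set.Icc 0 M) := by
    have hne : ∀ γ ∈ Set.Icc 0 M, 1 + γ ≠ 0 := fun γ hγ => by linarith [hγ.1]
    have hadd : ContinuousOn (fun γ : ℝ => 1 + γ) (Set.Icc 0 M) := by fun_prop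
    exact (hadd.log hne).sub (continuousOn_id.div hadd hne)
  have hlog : c + 1 ≤ Real.log (1 + M) :=
    (Real.le_log_iff_exp_le (by linarith)).2 (by linarith)
  have hdiv : M / (1 + M) ≤ 1 := (div_le_one (by linarith)).2 (by linarith)
  obtain ⟨γ, hγ, hγc⟩ := intermediate_value_Icc hM.le hcont
    (show c ∈ Set.Icc _ _ from ⟨by simpa using hc.le, by linarith⟩)
  refine ⟨γ, hγ.1.lt_of_ne ?_, hγc⟩
  rintro rfl
  simp at hγc
  linarith

theorem log_one_add_sub_div_lt {γ : ℝ} (hγ : 0 < γ) :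
    Real.log (1 + γ) - γ / (1 + γ) < γ ^ 2 / (1 + γ) := by
  have hlog := Real.log_lt_sub_one_of_pos (show 0 < 1 + γ by linarith) (by linarith)
  have hsum : γ / (1 + γ) + γ ^ 2 / (1 + γ) = γ := by
    field_simp
  linarith

/-- For ε > 0 and N > 0 there is a unique γ* > 0 with
N·(ln(1+γ*) − γ*/(1+γ*)) = 2ε², and it satisfies γ* > γ⁺ = (ε² + √(ε⁴ + 2ε²N))/N. -/
theorem stmt_4 (ε N : ℝ) (hε : ε > 0) (hN : N > 0) :
    let γp : ℝ := (ε ^ 2 + Real.sqrt (ε ^ 4 + 2 * ε ^ 2 * N)) / N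
    ∃ γs : ℝ, γs > 0 ∧ N * (Real.log (1 + γs) - γs / (1 + γs)) = 2 * ε ^ 2 ∧
      (∀ γ : ℝ, γ > 0 → N * (Real.log (1 + γ) - γ / (1 + γ)) = 2 * ε ^ 2 → γ = γs) ∧
      γs > γp := by
  intro γp
  obtain ⟨γs, hpos, hs⟩ :=
    exists_pos_log_one_add_sub_div_eq (show 0 < 2 * ε ^ 2 / N by positivity)
  have hroot : N * (Real.log (1 + γs) - γs / (1 + γs)) = 2 * ε ^ 2 := by
    rw [hs]
    field_simp
  refine ⟨γs, hpos, hroot, fun γ hγ h => ?_, ?_⟩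
  · exact strictMonoOn_log_one_add_sub_div.injOn hγ hpos
      (mul_left_cancel₀ hN.ne' (h.trans hroot.symm))
  · have hquad := log_one_add_sub_div_lt hpos
    rw [hs, div_lt_div_iff₀ hN (by linarith)] at hquad
    have hlin : 2 * ε ^ 2 < N * γs := by
      have : 0 < ε ^ 2 := by positivity
      by_contra! hle
      nlinarith [mul_le_mul_of_nonneg_right hle hpos.le]
    have hsqrt : Real.sqrt (ε ^ 4 + 2 * ε ^ 2 * N) < N * γs - ε ^ 2 := by
      rw [Real.sqrt_lt' (by nlinarith)]
      nlinarith [mul_lt_mul_of_pos_left hquad hN]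
    change (ε ^ 2 + Real.sqrt (ε ^ 4 + 2 * ε ^ 2 * N)) / N < γs
    rw [div_lt_iff₀ hN]
    linarith
end

section
/- Fix P_a > 0, σ_b² > 0, and h > 0, and define γ_b(P_b) = P_a/(σ_b² + h·P_b) for P_b ≥ 0. Then γ_b is strictly decreasing in P_b; consequently, if R·ln 2 ≥ (1/2)·ln N, the effective throughput P_b ↦ N·R·(1 − Q(ζ(γ_b(P_b)))) is strictly decreasing in the artificial-noise power P_b for fixed P_a. -/
open ProbabilityTheory

/-- The Gaussian Q-function: complementary CDF of a standard real Gaussian. -/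
noncomputable def gaussQ (x : ℝ) : ℝ := (gaussianReal 0 1 (Set.Ioi x)).toReal

open MeasureTheory in
/-- The Gaussian Q-function is strictly decreasing. -/
lemma gaussQ_strictAnti : StrictAnti gaussQ := by
  intro a b hab
  have hsplit : gaussianReal 0 1 (Set.Ioi a) =
      gaussianReal 0 1 (Set.Ioc a b) + gaussianReal 0 1 (Set.Ioi b) := by
    rw [← measure_union Set.Ioc_disjoint_Ioi_same measurableSet_Ioi,
      Set.Ioc_union_Ioi_eq_Ioi hab.le]
  have hne : gaussianReal 0 1 (Set.Ioc a b) ≠ 0 := fun h0 => by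
    have hvol := gaussianReal_absolutelyContinuous' 0 one_ne_zero h0
    rw [Real.volume_Ioc, ENNReal.ofReal_eq_zero] at hvol
    linarith
  unfold gaussQ
  rw [hsplit, ENNReal.toReal_add (measure_ne_top _ _) (measure_ne_top _ _)]
  linarith [ENNReal.toReal_pos hne (measure_ne_top _ _)]

/-- The normal-approximation argument `(1 + γ) (log (1 + γ) - c) / √(γ (γ + 2))` increases with the
SINR `γ > 0` whenever `c ≥ 0`. -/
lemma strictMonoOn_one_add_mul_log_sub_div_sqrt {c : ℝ} (hc : 0 ≤ c) :
    StrictMonoOn (fun γ : ℝ => (1 + γ) * (Real.log (1 + γ) - c) / Real.sqrt (γ * (γ + 2)))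
      (Set.Ioi 0) := by
  have hderiv : ∀ γ ∈ Set.Ioi (0 : ℝ), HasDerivAt
      (fun γ : ℝ => (1 + γ) * (Real.log (1 + γ) - c) / Real.sqrt (γ * (γ + 2)))
      ((γ * (γ + 2) - Real.log (1 + γ) + c) / Real.sqrt (γ * (γ + 2)) ^ 3) γ := by
    intro γ hγ
    rw [Set.mem_Ioi] at hγ
    have hx : 1 + γ ≠ 0 := by positivity
    have hp : 0 < γ * (γ + 2) := by positivity
    have hs : Real.sqrt (γ * (γ + 2)) ≠ 0 := (Real.sqrt_pos.2 hp).ne'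
    have hsq := Real.sq_sqrt hp.le
    have h1 : HasDerivAt (fun γ : ℝ => 1 + γ) 1 γ := (hasDerivAt_id γ).const_add 1
    have h2 : HasDerivAt (fun γ : ℝ => γ * (γ + 2)) (1 * (γ + 2) + γ * 1) γ :=
      (hasDerivAt_id γ).mul ((hasDerivAt_id γ).add_const 2)
    refine ((h1.mul ((h1.log hx).sub_const c)).div (h2.sqrt hp.ne') hs).congr_deriv ?_
    simp only [Pi.mul_apply]
    generalize Real.sqrt (γ * (γ + 2)) = s at hs hsq ⊢
    field_simp
    rw [hsq]
    ring
  refine strictMonoOn_of_deriv_pos (convex_Ioi 0)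
    (fun γ hγ => (hderiv γ hγ).continuousAt.continuousWithinAt) fun γ hγ => ?_
  rw [interior_Ioi] at hγ
  rw [(hderiv γ hγ).deriv]
  rw [Set.mem_Ioi] at hγ
  have hlog := Real.log_le_sub_one_of_pos (show 0 < 1 + γ by positivity)
  have hnum : 0 < γ * (γ + 2) - Real.log (1 + γ) + c := by nlinarith
  positivity

/-- With γ_b(P_b) = P_a/(σ_b² + h·P_b) (P_a > 0, σ_b² > 0, h > 0),
γ_b is strictly decreasing in P_b ≥ 0; consequently, if R·ln 2 ≥ (1/2)·ln N
(N > 0, R > 0), the effective throughput P_b ↦ N·R·(1 − Q(ζ(γ_b(P_b)))) is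
strictly decreasing on [0,∞). -/
theorem stmt_12 (N R Pa σb2 h : ℝ) (hN : N > 0) (hR : R > 0) (hPa : Pa > 0)
    (hσb : σb2 > 0) (hh : h > 0) (hRN : R * Real.log 2 ≥ (1 / 2) * Real.log N) :
    let γb : ℝ → ℝ := fun Pb => Pa / (σb2 + h * Pb)
    let ζ : ℝ → ℝ := fun γ =>
      Real.sqrt N * (1 + γ) * (Real.log (1 + γ) + (1 / 2) * Real.log N - R * Real.log 2) /
        Real.sqrt (γ * (γ + 2))
    StrictAntiOn γb (Set.Ici 0) ∧
    StrictAntiOn (fun Pb => N * R * (1 - gaussQ (ζ (γb Pb)))) (Set.Ici 0) := by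
  intro γb ζ
  have hden : ∀ P ∈ Set.Ici (0 : ℝ), 0 < σb2 + h * P := fun P hP => by
    rw [Set.mem_Ici] at hP
    positivity
  have hγ : StrictAntiOn γb (Set.Ici 0) := fun P hP P' _ hPP' =>
    div_lt_div_of_pos_left hPa (hden P hP) (by gcongr)
  have hζ : StrictMonoOn ζ (Set.Ioi 0) := by
    have hc : 0 ≤ R * Real.log 2 - 1 / 2 * Real.log N := by linarith
    have hmul := (strictMono_mul_left_of_pos (Real.sqrt_pos.2 hN)).comp_strictMonoOn
      (strictMonoOn_one_add_mul_log_sub_div_sqrt hc)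
    refine hmul.congr fun γ _ => ?_
    simp only [ζ, Function.comp_apply]
    ring
  refine ⟨hγ, fun P hP P' hP' hPP' => ?_⟩
  have hQ := gaussQ_strictAnti
    (hζ (div_pos hPa (hden P' hP')) (div_pos hPa (hden P hP)) (hγ hP hP' hPP'))
  exact mul_lt_mul_of_pos_left (sub_lt_sub_left hQ 1) (mul_pos hN hR)
end
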